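/- arXiv:0712.2290 — 2 statements merged into one kernel-verified Lean document; each statement's English description precedes it below -/
import Mathlib

section
/- For the group G₂ with distinguished element β: the automorphism τ of A(G₂, β) satisfies τ² − τ + id = 0, so that A(G₂, β) is a module over Λ = ℤ[t]/(t² − t + 1) with t acting as τ; this Λ-module is free of rank 2, with basis the classes of αβ⁻¹ and γβ⁻¹. (This is the Alexander module of any plane sextic of weight eight.) -/
namespace Sextics

abbrev F5 := FreeGroup (Fin 5)

def fa : F5 := FreeGroup.of 0
def fa' : F5 := FreeGroup.of 1
def fb : F5 := FreeGroup.of 2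
def fc : F5 := FreeGroup.of 3
def fc' : F5 := FreeGroup.of 4

/-- Relators of the group `G̃`: the braid relations `αβα = βαβ`, `ᾱβᾱ = βᾱβ`,
`γβγ = βγβ`, `γ̄βγ̄ = βγ̄β` and the relation at infinity `βγαβγ̄ᾱ = 1`. -/
def relsT : Set F5 :=
  {fa * fb * fa * (fb * fa * fb)⁻¹, fa' * fb * fa' * (fb * fa' * fb)⁻¹,
   fc * fb * fc * (fb * fc * fb)⁻¹, fc' * fb * fc' * (fb * fc' * fb)⁻¹,
   fb * fc * fa * fb * fc' * fa'}

abbrev Gt := PresentedGroup relsT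

def at' : Gt := PresentedGroup.of 0
def abt : Gt := PresentedGroup.of 1
def bt : Gt := PresentedGroup.of 2
def ct : Gt := PresentedGroup.of 3
def cbt : Gt := PresentedGroup.of 4

/-- Relators of `G₂`: those of `G̃` together with `ᾱγα = αγ̄ᾱ`, `αγ̄ᾱ = γαγ̄`,
`γαγ̄ = γ̄ᾱγ`. -/
def rels2 : Set F5 :=
  relsT ∪
    {fa' * fc * fa * (fa * fc' * fa')⁻¹, fa * fc' * fa' * (fc * fa * fc')⁻¹,
     fc * fa * fc' * (fc' * fa' * fc)⁻¹}

abbrev G2 := PresentedGroup rels2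

def a2 : G2 := PresentedGroup.of 0
def a2' : G2 := PresentedGroup.of 1
def b2 : G2 := PresentedGroup.of 2
def c2 : G2 := PresentedGroup.of 3
def c2' : G2 := PresentedGroup.of 4

/-- Conjugation by `g` restricted to the commutator subgroup `G′`. -/
def conjSub {G : Type*} [Group G] (g : G) : ↥(commutator G) →* ↥(commutator G) where
  toFun x := ⟨g * (x : G) * g⁻¹, Subgroup.Normal.conj_mem inferInstance (x : G) x.2 g⟩
  map_one' := by ext; simp
  map_mul' x y := by ext; simp [mul_assoc]

/-- The Alexander module `A(G, g) = G′/G″` of a group `G`, written additively.  (The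
distinguished element `g` enters through the automorphism `tau g` below.) -/
abbrev AlexMod (G : Type*) [Group G] := Additive (Abelianization ↥(commutator G))

/-- The automorphism `τ` of `A(G, g)` induced by conjugation by `g`: `τ[x] = [g x g⁻¹]`. -/
def tau {G : Type*} [Group G] (g : G) : AlexMod G → AlexMod G :=
  fun x => Additive.ofMul (Abelianization.map (conjSub g) (Additive.toMul x))

/-- The class in `A(G, g)` of an element of the derived subgroup. -/
def cls {G : Type*} [Group G] {w : G} (h : w ∈ commutator G) : AlexMod G :=
  Additive.ofMul (Abelianization.of (⟨w, h⟩ : ↥(commutator G)))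

/-- The ring `Λ = ℤ[t]/(t² − t + 1)`. -/
abbrev Lam :=
  Polynomial ℤ ⧸ Ideal.span ({Polynomial.X ^ 2 - Polynomial.X + 1} : Set (Polynomial ℤ))

/-- The class `t ∈ Λ`. -/
noncomputable def tL : Lam := Ideal.Quotient.mk _ Polynomial.X

/-- The scalar multiplication of an explicitly given module structure. -/
def smulOf {R M : Type*} [Semiring R] [AddCommMonoid M] (inst : Module R M)
    (r : R) (m : M) : M :=
  @SMul.smul R M inst.toDistribMulAction.toMulAction.toSMul r m

end Sextics

namespace Sextics

open scoped commutatorElement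

section General

variable {G : Type*} [Group G] {g : G}

/-- Conjugation by `g` on the Alexander module, as an additive homomorphism. -/
def tauHom (g : G) : AddMonoid.End (AlexMod G) :=
  MonoidHom.toAdditive (Abelianization.map (conjSub g))

theorem tauHom_apply (g : G) (x : AlexMod G) : tauHom g x = tau g x := rfl

theorem tau_add (g : G) (x y : AlexMod G) : tau g (x + y) = tau g x + tau g y :=
  map_add (tauHom g) x y

theorem tau_zero (g : G) : tau g (0 : AlexMod G) = 0 := map_zero (tauHom g)

theorem tau_sub (g : G) (x y : AlexMod G) : tau g (x - y) = tau g x - tau g y :=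
  map_sub (tauHom g) x y

theorem conj_mem_commutator {w : G} (h : w ∈ commutator G) (g : G) :
    g * w * g⁻¹ ∈ commutator G :=
  Subgroup.Normal.conj_mem inferInstance w h g

theorem cls_mul {w w' : G} (h : w ∈ commutator G) (h' : w' ∈ commutator G) :
    cls (mul_mem h h') = cls h + cls h' := rfl

theorem cls_one : cls (one_mem (commutator G)) = 0 := rfl

theorem cls_inv {w : G} (h : w ∈ commutator G) : cls (inv_mem h) = -cls h := rfl

theorem tau_cls (g : G) {w : G} (h : w ∈ commutator G) :
    tau g (cls h) = cls (conj_mem_commutator h g) := rfl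

theorem cls_congr {w w' : G} (h : w ∈ commutator G) (h' : w' ∈ commutator G) (e : w = w') :
    cls h = cls h' := by
  subst e; rfl

theorem exists_cls (x : AlexMod G) : ∃ (w : G) (h : w ∈ commutator G), cls h = x := by
  obtain ⟨y, hy⟩ := QuotientGroup.mk_surjective (Additive.toMul x)
  exact ⟨y, y.2, congrArg Additive.ofMul hy⟩

theorem tau_of_mem {w : G} (hw : w ∈ commutator G) (x : AlexMod G) : tau w x = x := by
  obtain ⟨y, hy, rfl⟩ := exists_cls x
  change cls (mul_mem (mul_mem hw hy) (inv_mem hw)) = _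
  rw [cls_mul (mul_mem hw hy) (inv_mem hw), cls_mul hw hy, cls_inv hw]
  abel

theorem tau_mul (g h : G) (x : AlexMod G) : tau (g * h) x = tau g (tau h x) := by
  obtain ⟨y, hy, rfl⟩ := exists_cls x
  simp only [tau_cls]
  exact cls_congr _ _ (by group)

theorem tau_one (x : AlexMod G) : tau (1 : G) x = x := tau_of_mem (one_mem _) x

theorem tau_inv_tau (g : G) (x : AlexMod G) : tau g⁻¹ (tau g x) = x := by
  rw [← tau_mul, inv_mul_cancel, tau_one]

theorem tau_eq_of_mem {s : G} (h : s * g⁻¹ ∈ commutator G) (x : AlexMod G) :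
    tau s x = tau g x := by
  conv_lhs => rw [← inv_mul_cancel_right s g, tau_mul, tau_of_mem h]

/-- An additive subgroup of the Alexander module that is stable under `τ` and its inverse and
contains the classes of `s g⁻¹` for `s` in a generating set is everything. -/
theorem eq_top_of_generators {S : Set G} (hS : Subgroup.closure S = ⊤)
    (N : AddSubgroup (AlexMod G)) (hN : ∀ x, tau g x ∈ N ↔ x ∈ N)
    (hmem : ∀ s ∈ S, ∃ h : s * g⁻¹ ∈ commutator G, cls h ∈ N) : N = ⊤ := by
  have stable : ∀ (h : G) (x : AlexMod G), tau h x ∈ N ↔ x ∈ N := by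
    intro h
    have hh : h ∈ Subgroup.closure S := hS ▸ Subgroup.mem_top h
    induction hh using Subgroup.closure_induction with
    | mem s hs =>
      obtain ⟨hs', -⟩ := hmem s hs
      intro x
      rw [tau_eq_of_mem hs', hN]
    | one => intro x; rw [tau_one]
    | mul a b _ _ ha hb => intro x; rw [tau_mul, ha, hb]
    | inv a _ ha => intro x; rw [← ha, ← tau_mul, mul_inv_cancel, tau_one]
  let P : Subgroup G :=
    { carrier := {w | ∃ h : w ∈ commutator G, cls h ∈ N}
      mul_mem' := fun ⟨h, hx⟩ ⟨h', hx'⟩ => ⟨mul_mem h h', N.add_mem hx hx'⟩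
      one_mem' := ⟨one_mem _, N.zero_mem⟩
      inv_mem' := fun ⟨h, hx⟩ => ⟨inv_mem h, N.neg_mem hx⟩ }
  have hP : P.Normal :=
    ⟨fun w ⟨h, hx⟩ k => ⟨conj_mem_commutator h k, (stable k (cls h)).2 hx⟩⟩
  have cyclic : ∀ h : G, (h : G ⧸ P) ∈ Subgroup.zpowers (g : G ⧸ P) := by
    intro h
    have hh : h ∈ Subgroup.closure S := hS ▸ Subgroup.mem_top h
    induction hh using Subgroup.closure_induction with
    | mem s hs =>
      have : (s : G ⧸ P) = g := by
        have h1 : ((s * g⁻¹ : G) : G ⧸ P) = 1 := (QuotientGroup.eq_one_iff _).2 (hmem s hs)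
        rwa [QuotientGroup.mk_mul, QuotientGroup.mk_inv, mul_inv_eq_one] at h1
      exact this ▸ Subgroup.mem_zpowers _
    | one => exact one_mem _
    | mul a b _ _ ha hb => exact mul_mem ha hb
    | inv a _ ha => exact inv_mem ha
  have hle : commutator G ≤ P := by
    rw [commutator_def, Subgroup.commutator_le]
    intro a _ b _
    rw [← QuotientGroup.eq_one_iff]
    obtain ⟨m, hm⟩ := cyclic a
    obtain ⟨n, hn⟩ := cyclic b
    change ⁅(a : G ⧸ P), (b : G ⧸ P)⁆ = 1
    rw [← hm, ← hn, commutatorElement_eq_one_iff_commute]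
    exact Commute.zpow_zpow_self _ m n
  rw [eq_top_iff]
  intro x _
  obtain ⟨w, h, rfl⟩ := exists_cls x
  exact (hle h).2

theorem mul_inv_mem_of_braid {s : G} (h : s * g * s = g * s * g) : s * g⁻¹ ∈ commutator G := by
  have e : s * g⁻¹ = ⁅s, s * g⁆ := by
    rw [commutatorElement_def, eq_mul_inv_iff_mul_eq, eq_mul_inv_iff_mul_eq]
    calc s * g⁻¹ * (s * g) * s = s * g⁻¹ * (s * g * s) := by group
      _ = s * (s * g) := by rw [h]; group
  rw [e]
  exact Subgroup.commutator_mem_commutator (Subgroup.mem_top _) (Subgroup.mem_top _)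

theorem cls_word_three {x y z x' y' z' : G}
    (hx : x * g⁻¹ ∈ commutator G) (hy : y * g⁻¹ ∈ commutator G) (hz : z * g⁻¹ ∈ commutator G)
    (hx' : x' * g⁻¹ ∈ commutator G) (hy' : y' * g⁻¹ ∈ commutator G)
    (hz' : z' * g⁻¹ ∈ commutator G) (e : x * y * z = x' * y' * z') :
    cls hx + tau g (cls hy) + tau g (tau g (cls hz)) =
      cls hx' + tau g (cls hy') + tau g (tau g (cls hz')) := by
  simp only [tau_cls, ← cls_mul]
  apply cls_congr
  calc _ = x * y * z * g⁻¹ ^ 3 := by group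
    _ = x' * y' * z' * g⁻¹ ^ 3 := by rw [e]
    _ = _ := by group

theorem tau_tau_cls_of_braid {s : G} (h : s * g⁻¹ ∈ commutator G) (e : s * g * s = g * s * g) :
    tau g (tau g (cls h)) - tau g (cls h) + cls h = 0 := by
  have hg : g * g⁻¹ ∈ commutator G := by rw [mul_inv_cancel]; exact one_mem _
  have hg0 : cls hg = 0 := cls_congr hg (one_mem _) (mul_inv_cancel g)
  have := cls_word_three h hg h hg h hg e
  simp only [hg0, tau_zero, add_zero, zero_add] at this
  rw [add_comm] at this
  rw [sub_add_eq_add_sub, this, sub_self]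

/-- The endomorphism `τ² - τ + 1`. -/
def tauQuad (g : G) : AddMonoid.End (AlexMod G) := tauHom g ^ 2 - tauHom g + 1

theorem tauQuad_apply (g : G) (x : AlexMod G) :
    tauQuad g x = tau g (tau g x) - tau g x + x := rfl

/-- If a group is generated by elements braided with `g`, then `τ² - τ + 1 = 0`. -/
theorem tau_tau_eq_of_braid {S : Set G} (hS : Subgroup.closure S = ⊤)
    (hb : ∀ s ∈ S, s * g * s = g * s * g) (x : AlexMod G) :
    tau g (tau g x) - tau g x + x = 0 := by
  have htop : AddMonoidHom.ker (tauQuad g : AlexMod G →+ AlexMod G) = ⊤ := by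
    refine eq_top_of_generators (g := g) hS _ (fun y => ?_) (fun s hs => ?_)
    · have e : tauQuad g (tau g y) = tau g (tauQuad g y) := by
        simp only [tauQuad_apply, tau_add, tau_sub]
      change tauQuad g (tau g y) = 0 ↔ tauQuad g y = 0
      rw [e]
      refine ⟨fun h => ?_, fun h => by rw [h, tau_zero]⟩
      rw [← tau_inv_tau g (tauQuad g y), h, tau_zero]
    · exact ⟨mul_inv_mem_of_braid (hb s hs), tau_tau_cls_of_braid _ (hb s hs)⟩
  exact AddMonoidHom.mem_ker.1 (htop ▸ AddSubgroup.mem_top x)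

/-- The action of `Λ` on the Alexander module when `τ² - τ + 1 = 0`. -/
noncomputable def lamAction (hq : ∀ x : AlexMod G, tau g (tau g x) - tau g x + x = 0) :
    Lam →+* AddMonoid.End (AlexMod G) :=
  Ideal.Quotient.lift _ (Polynomial.aeval (R := ℤ) (tauHom g)).toRingHom <| by
    have h0 : tauHom g ^ 2 - tauHom g + 1 = 0 := AddMonoidHom.ext hq
    intro p hp
    obtain ⟨q, rfl⟩ := Ideal.mem_span_singleton.1 hp
    simp [h0]

theorem lamAction_add_apply (hq : ∀ x : AlexMod G, tau g (tau g x) - tau g x + x = 0)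
    (r s : Lam) (x : AlexMod G) : lamAction hq (r + s) x = lamAction hq r x + lamAction hq s x := by
  rw [map_add]; rfl

theorem lamAction_mul_apply (hq : ∀ x : AlexMod G, tau g (tau g x) - tau g x + x = 0)
    (r s : Lam) (x : AlexMod G) : lamAction hq (r * s) x = lamAction hq r (lamAction hq s x) := by
  rw [map_mul]; rfl

theorem lamAction_tL (hq : ∀ x : AlexMod G, tau g (tau g x) - tau g x + x = 0)
    (x : AlexMod G) : lamAction hq tL x = tau g x := by
  have : lamAction hq tL = tauHom g := by simp [lamAction, tL]
  rw [this, tauHom_apply]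

/-- An additive map from the Alexander module to a `Λ`-module that intertwines `τ` and `t` is
`Λ`-linear. -/
theorem map_lamAction (hq : ∀ x : AlexMod G, tau g (tau g x) - tau g x + x = 0)
    {V : Type*} [AddCommGroup V] [Module Lam V] (f : AlexMod G →+ V)
    (hf : ∀ x, f (tau g x) = tL • f x) (r : Lam) (x : AlexMod G) :
    f (lamAction hq r x) = r • f x := by
  obtain ⟨p, rfl⟩ := Ideal.Quotient.mk_surjective r
  induction p using Polynomial.induction_on' generalizing x with
  | add p q hp hq' => rw [map_add, lamAction_add_apply, map_add, hp, hq', add_smul]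
  | monomial n a =>
    induction n generalizing x with
    | zero =>
      rw [Polynomial.monomial_zero_left, ← Polynomial.algebraMap_eq, eq_intCast, map_intCast,
        map_intCast, Int.cast_smul_eq_zsmul, ← map_zsmul]
      rfl
    | succ n ih =>
      rw [← Polynomial.monomial_mul_X, map_mul, lamAction_mul_apply, ih]
      change _ • f (lamAction hq tL x) = (_ * tL) • _
      rw [lamAction_tL, hf, mul_smul]

end General

theorem tL_quad : tL ^ 2 - tL + 1 = 0 := by
  have : Ideal.Quotient.mk (Ideal.span {(Polynomial.X ^ 2 - Polynomial.X + 1 : Polynomial ℤ)})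
      (Polynomial.X ^ 2 - Polynomial.X + 1) = 0 :=
    Ideal.Quotient.eq_zero_iff_mem.2 (Ideal.mem_span_singleton_self _)
  rwa [map_add, map_sub, map_pow, map_one] at this

/-- `t` as a unit of `Λ`. -/
noncomputable def tU : Lamˣ where
  val := tL
  inv := 1 - tL
  val_inv := by linear_combination -tL_quad
  inv_val := by linear_combination -tL_quad

section Affine

variable (R V : Type*) [CommRing R] [AddCommGroup V] [Module R V]

/-- Scalar units acting on the multiplicative copy of a module. -/
def unitsAction : Rˣ →* MulAut (Multiplicative V) :=
  (MulAutMultiplicative V).symm.toMonoidHom.comp (DistribMulAction.toAddAut Rˣ V)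

/-- The group of affine maps `x ↦ u x + v` with `u` a unit scalar. -/
abbrev ScalarAffine := Multiplicative V ⋊[unitsAction R V] Rˣ

variable {R V}

theorem toAdd_unitsAction (u : Rˣ) (v : Multiplicative V) :
    (unitsAction R V u v).toAdd = u • v.toAdd := rfl

variable {G : Type*} [Group G] (f : G →* ScalarAffine R V)

theorem right_eq_one_of_mem_commutator {w : G} (h : w ∈ commutator G) : (f w).right = 1 :=
  Abelianization.commutator_subset_ker (SemidirectProduct.rightHom.comp f) h

/-- The translation part of a representation by scalar affine maps, on the Alexander module. -/
def translationPart : AlexMod G →+ V :=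
  MonoidHom.toAdditiveLeft <| Abelianization.lift
    { toFun := fun w => (f w).left
      map_one' := by simp
      map_mul' := fun x y => by
        simp [right_eq_one_of_mem_commutator f x.2] }

theorem translationPart_cls {w : G} (h : w ∈ commutator G) :
    translationPart f (cls h) = (f w).left.toAdd := rfl

theorem translationPart_tau {g : G} (hg : (f g).left = 1) (x : AlexMod G) :
    translationPart f (tau g x) = (f g).right • translationPart f x := by
  obtain ⟨w, h, rfl⟩ := exists_cls x
  rw [tau_cls, translationPart_cls, translationPart_cls]
  simp [hg, toAdd_unitsAction]

end Affine

/-- Images of the generators in the affine group of `Λ²`. -/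
noncomputable def affineGen : Fin 5 → ScalarAffine Lam (Fin 2 → Lam) :=
  ![⟨.ofAdd ![1, 0], tU⟩, ⟨.ofAdd ![1, 0], tU⟩, ⟨.ofAdd 0, tU⟩,
    ⟨.ofAdd ![0, 1], tU⟩, ⟨.ofAdd ![0, 1], tU⟩]

theorem scalarAffine_ext {x y : ScalarAffine Lam (Fin 2 → Lam)}
    (h0 : x.left.toAdd 0 = y.left.toAdd 0) (h1 : x.left.toAdd 1 = y.left.toAdd 1)
    (hr : (x.right : Lam) = y.right) : x = y := by
  refine SemidirectProduct.ext (Multiplicative.toAdd.injective (funext fun i => ?_)) (Units.ext hr)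
  fin_cases i
  · exact h0
  · exact h1

theorem tU_val : (tU : Lam) = tL := rfl

theorem lift_affineGen_eq_one : ∀ r ∈ rels2, FreeGroup.lift affineGen r = 1 := by
  have ht := tL_quad
  rintro r ((rfl | rfl | rfl | rfl | rfl) | (rfl | rfl | rfl)) <;>
  simp only [fa, fa', fb, fc, fc', map_mul, map_inv, FreeGroup.lift_apply_of, mul_inv_eq_one] <;>
  apply scalarAffine_ext <;>
  simp [affineGen, toAdd_unitsAction, Units.smul_def, tU_val]
  case inl.inr.inr.inr.inr.h0 => linear_combination (tL ^ 3 + tL ^ 2) * ht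
  case inl.inr.inr.inr.inr.h1 => linear_combination (tL ^ 2 + tL) * ht
  case inl.inr.inr.inr.inr.hr => linear_combination (tL ^ 4 + tL ^ 3 - tL - 1) * ht
  case inr.inr.inl.h1 => linear_combination -ht
  all_goals linear_combination ht

/-- The affine representation of `G₂` on `Λ²`. -/
noncomputable def affineRep : G2 →* ScalarAffine Lam (Fin 2 → Lam) :=
  PresentedGroup.toGroup lift_affineGen_eq_one

theorem affineRep_of (i : Fin 5) : affineRep (PresentedGroup.of i) = affineGen i :=
  PresentedGroup.toGroup.of _

theorem eq_of_mul_inv_mem_rels2 {u v : F5} (h : u * v⁻¹ ∈ rels2) :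
    PresentedGroup.mk rels2 u = PresentedGroup.mk rels2 v := by
  have := PresentedGroup.one_of_mem h
  rwa [map_mul, map_inv, mul_inv_eq_one] at this

theorem braid_b2 (i : Fin 5) :
    (PresentedGroup.of i : G2) * b2 * PresentedGroup.of i =
      b2 * PresentedGroup.of i * b2 := by
  fin_cases i
  · exact eq_of_mul_inv_mem_rels2 (u := fa * fb * fa) (v := fb * fa * fb) (by simp [rels2, relsT])
  · exact eq_of_mul_inv_mem_rels2 (u := fa' * fb * fa') (v := fb * fa' * fb)
      (by simp [rels2, relsT])
  · rfl
  · exact eq_of_mul_inv_mem_rels2 (u := fc * fb * fc) (v := fb * fc * fb) (by simp [rels2, relsT])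
  · exact eq_of_mul_inv_mem_rels2 (u := fc' * fb * fc') (v := fb * fc' * fb)
      (by simp [rels2, relsT])

theorem relation_at_infinity : b2 * c2 * a2 * b2 * c2' * a2' = 1 :=
  PresentedGroup.one_of_mem (rels := rels2) (x := fb * fc * fa * fb * fc' * fa')
    (by simp [rels2, relsT])

theorem relation_additional : a2' * c2 * a2 = a2 * c2' * a2' :=
  eq_of_mul_inv_mem_rels2 (u := fa' * fc * fa) (v := fa * fc' * fa') (by simp [rels2])

theorem gen_mul_inv_mem (i : Fin 5) : (PresentedGroup.of i : G2) * b2⁻¹ ∈ commutator G2 :=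
  mul_inv_mem_of_braid (braid_b2 i)

theorem tau_quad_b2 (x : AlexMod G2) : tau b2 (tau b2 x) - tau b2 x + x = 0 :=
  tau_tau_eq_of_braid (PresentedGroup.closure_range_of rels2)
    (by rintro _ ⟨i, rfl⟩; exact braid_b2 i) x

theorem tau_tau_b2 (x : AlexMod G2) : tau b2 (tau b2 x) = tau b2 x - x := by
  rw [← sub_eq_zero, ← tau_quad_b2 x]
  abel

/-- The class of a generator times `β⁻¹`. -/
def genCls (i : Fin 5) : AlexMod G2 := cls (gen_mul_inv_mem i)

theorem genCls_b2 : genCls 2 = 0 := cls_congr _ (one_mem _) (mul_inv_cancel b2)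

theorem b2_pow_six_mem : b2 ^ 6 ∈ commutator G2 := by
  rw [← Abelianization.ker_of G2, MonoidHom.mem_ker]
  have key : ∀ i, Abelianization.of (PresentedGroup.of i : G2) = Abelianization.of b2 := fun i => by
    have h := gen_mul_inv_mem i
    rwa [← Abelianization.ker_of G2, MonoidHom.mem_ker, map_mul, map_inv, mul_inv_eq_one] at h
  have h := congrArg Abelianization.of relation_at_infinity
  simp only [map_mul, map_one] at h
  rw [show Abelianization.of c2 = Abelianization.of b2 from key 3,
    show Abelianization.of a2 = Abelianization.of b2 from key 0,
    show Abelianization.of c2' = Abelianization.of b2 from key 4,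
    show Abelianization.of a2' = Abelianization.of b2 from key 1] at h
  rw [map_pow, ← h]
  simp only [pow_succ, pow_zero, one_mul]

theorem cls_b2_pow_six : cls b2_pow_six_mem = 0 := by
  have h : tau b2 (cls b2_pow_six_mem) = cls b2_pow_six_mem := cls_congr _ _ (by group)
  simpa [h] using tau_quad_b2 (cls b2_pow_six_mem)

theorem genCls_at_infinity :
    tau b2 (genCls 3) + tau b2 (tau b2 (genCls 0)) =
      tau b2 (genCls 4) + tau b2 (tau b2 (genCls 1)) := by
  have h : tau b2 (genCls 3) + tau b2 (tau b2 (genCls 0)) +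
      tau b2 (tau b2 (tau b2 (tau b2 (genCls 4)))) +
      tau b2 (tau b2 (tau b2 (tau b2 (tau b2 (genCls 1))))) + cls b2_pow_six_mem = 0 := by
    rw [← cls_one]
    simp only [genCls, tau_cls, ← cls_mul]
    apply cls_congr
    refine Eq.trans ?_ relation_at_infinity
    simp only [a2, a2', c2, c2']
    group
  have cube : ∀ x : AlexMod G2, tau b2 (tau b2 (tau b2 x)) = -x := fun x => by
    rw [tau_tau_b2 x, tau_sub, tau_tau_b2 x]
    abel
  rw [cube, cube, cls_b2_pow_six, add_zero] at h
  rw [← sub_eq_zero, ← h]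
  abel

theorem genCls_additional :
    genCls 1 + tau b2 (genCls 3) + tau b2 (tau b2 (genCls 0)) =
      genCls 0 + tau b2 (genCls 4) + tau b2 (tau b2 (genCls 1)) :=
  cls_word_three _ _ _ _ _ _ relation_additional

theorem genCls_one : genCls 1 = genCls 0 := by
  have h := genCls_additional
  rw [add_assoc, add_assoc, genCls_at_infinity] at h
  exact add_right_cancel h

theorem genCls_four : genCls 4 = genCls 3 := by
  have h := genCls_at_infinity
  rw [genCls_one] at h
  have h' := congrArg (tau b2⁻¹) (add_right_cancel h)
  rwa [tau_inv_tau, tau_inv_tau, eq_comm] at h'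

/-- The map `Λ² → A(G₂, β)` given by the classes of `αβ⁻¹` and `γβ⁻¹`. -/
noncomputable def combHom : (Fin 2 → Lam) →+ AlexMod G2 where
  toFun v := lamAction tau_quad_b2 (v 0) (genCls 0) + lamAction tau_quad_b2 (v 1) (genCls 3)
  map_zero' := by simp
  map_add' v w := by
    simp only [Pi.add_apply, lamAction_add_apply]
    abel

theorem combHom_apply (v : Fin 2 → Lam) : combHom v =
    lamAction tau_quad_b2 (v 0) (genCls 0) + lamAction tau_quad_b2 (v 1) (genCls 3) := rfl

theorem combHom_smul (r : Lam) (v : Fin 2 → Lam) :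
    combHom (r • v) = lamAction tau_quad_b2 r (combHom v) := by
  simp only [combHom_apply, Pi.smul_apply, smul_eq_mul, lamAction_mul_apply, map_add]

theorem combHom_surjective : Function.Surjective combHom := by
  have h0 : genCls 0 ∈ combHom.range := ⟨![1, 0], by simp [combHom_apply]⟩
  have h3 : genCls 3 ∈ combHom.range := ⟨![0, 1], by simp [combHom_apply]⟩
  rw [← AddMonoidHom.range_eq_top]
  refine eq_top_of_generators (g := b2) (PresentedGroup.closure_range_of rels2) _ (fun x => ?_) ?_
  · have stable : ∀ y, y ∈ combHom.range → tau b2 y ∈ combHom.range := by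
      rintro _ ⟨v, rfl⟩
      exact ⟨tL • v, by rw [combHom_smul, lamAction_tL]⟩
    refine ⟨fun h => ?_, stable x⟩
    have e : x = tau b2 x - tau b2 (tau b2 x) := by rw [tau_tau_b2]; abel
    rw [e]
    exact sub_mem h (stable _ h)
  · rintro _ ⟨i, rfl⟩
    refine ⟨gen_mul_inv_mem i, ?_⟩
    change genCls i ∈ _
    fin_cases i
    · exact h0
    · exact genCls_one ▸ h0
    · exact genCls_b2 ▸ zero_mem _
    · exact h3
    · exact genCls_four ▸ h3

theorem translationPart_genCls (i : Fin 5) :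
    translationPart affineRep (genCls i) = (affineGen i).left.toAdd := by
  have hb : affineRep b2 = affineGen 2 := affineRep_of 2
  rw [genCls, translationPart_cls, map_mul, map_inv, affineRep_of, hb]
  simp [affineGen]

theorem translationPart_combHom (v : Fin 2 → Lam) :
    translationPart affineRep (combHom v) = v := by
  have hb : affineRep b2 = affineGen 2 := affineRep_of 2
  have ht : ∀ x, translationPart affineRep (tau b2 x) = tL • translationPart affineRep x :=
    fun x => by
      rw [translationPart_tau _ (by rw [hb]; rfl), hb]
      rfl
  rw [combHom_apply, map_add, map_lamAction _ _ ht, map_lamAction _ _ ht,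
    translationPart_genCls, translationPart_genCls]
  ext i
  fin_cases i <;> simp [affineGen]

end Sextics

open Sextics

/-- The Alexander module of the group `G₂`, with distinguished element `β`: the
automorphism `τ` satisfies `τ² − τ + id = 0`, making `A(G₂, β)` a module over
`Λ = ℤ[t]/(t² − t + 1)` with `t` acting as `τ`, and this module is free of rank `2` with
basis the classes of `αβ⁻¹` and `γβ⁻¹`.  (This is the Alexander module of any plane
sextic of weight eight.) -/
theorem alexander_module_G2 :
    (∀ x : AlexMod G2, tau b2 (tau b2 x) - tau b2 x + x = 0) ∧
    ∃ (h1 : a2 * b2⁻¹ ∈ commutator G2) (h2 : c2 * b2⁻¹ ∈ commutator G2)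
      (inst : Module Lam (AlexMod G2)),
      (∀ x : AlexMod G2, smulOf inst tL x = tau b2 x) ∧
      Function.Bijective (fun v : Fin 2 → Lam =>
        smulOf inst (v 0) (cls h1) + smulOf inst (v 1) (cls h2)) := by
  exact ⟨tau_quad_b2, gen_mul_inv_mem 0, gen_mul_inv_mem 3,
    Module.compHom _ (lamAction tau_quad_b2), lamAction_tL tau_quad_b2,
    Function.LeftInverse.injective translationPart_combHom, combHom_surjective⟩
end

section
/- Let M be an even unimodular lattice, L ⊆ M a sublattice on which the restricted bilinear form is nondegenerate, L̃ the primitive hull of L in M, K ⊆ 𝓛 = L*/L the kernel of the finite-index extension L̃ ⊇ L, and L^⊥ the orthogonal complement of L in M. Let c : L → L be an isometry of L. Then there exists an isometry of M whose restriction to L is c and whose restriction to L^⊥ is the identity if and only if the automorphism of 𝓛 induced by c maps K onto K and the induced automorphism of K^⊥/K is the identity, where K^⊥ is the orthogonal complement of K in 𝓛 with respect to the discriminant bilinear form. -/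
open TensorProduct

namespace Lattices

variable {M : Type*} [AddCommGroup M]

/-- The orthogonal complement `L^⊥` of a sublattice `L` in `(M, B)`. -/
def perp (B : M →ₗ[ℤ] M →ₗ[ℤ] ℤ) (L : Submodule ℤ M) : Submodule ℤ M where
  carrier := {x | ∀ y ∈ L, B x y = 0}
  add_mem' := by
    intro a b ha hb y hy
    simp only [Set.mem_setOf_eq] at ha hb ⊢
    rw [map_add, LinearMap.add_apply, ha y hy, hb y hy, add_zero]
  zero_mem' := by
    intro y hy
    simp
  smul_mem' := by
    intro n a ha y hy
    simp only [Set.mem_setOf_eq] at ha ⊢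
    rw [map_smul, LinearMap.smul_apply, ha y hy, smul_zero]

/-- The primitive hull `L̃ = {x ∈ M | n·x ∈ L for some n ≠ 0}` of a sublattice `L ⊆ M`. -/
def primHull (L : Submodule ℤ M) : Submodule ℤ M where
  carrier := {x | ∃ n : ℤ, n ≠ 0 ∧ n • x ∈ L}
  zero_mem' := ⟨1, one_ne_zero, by simp⟩
  add_mem' := by
    rintro a b ⟨n, hn, ha⟩ ⟨m, hm, hb⟩
    refine ⟨n * m, mul_ne_zero hn hm, ?_⟩
    have h1 : (n * m) • a = m • (n • a) := by rw [mul_comm, mul_smul]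
    have h2 : (n * m) • b = n • (m • b) := mul_smul n m b
    rw [smul_add, h1, h2]
    exact L.add_mem (L.smul_mem m ha) (L.smul_mem n hb)
  smul_mem' := by
    rintro c a ⟨n, hn, ha⟩
    exact ⟨n, hn, by rw [smul_comm]; exact L.smul_mem c ha⟩

/-- `V = ℚ ⊗ M`, the ambient rational vector space of the lattice `M`. -/
abbrev V (M : Type*) [AddCommGroup M] := ℚ ⊗[ℤ] M

/-- The canonical map `M → ℚ ⊗ M`, `x ↦ 1 ⊗ x`. -/
noncomputable def ι : M →ₗ[ℤ] V M := TensorProduct.mk ℤ ℚ M 1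

/-- The `ℚ`-bilinear extension of `B` to `V = ℚ ⊗ M`. -/
noncomputable def BQ (B : M →ₗ[ℤ] M →ₗ[ℤ] ℤ) :
    V M →ₗ[ℚ] V M →ₗ[ℚ] ℚ :=
  LinearMap.BilinForm.baseChange ℚ B

/-- The `ℤ`-submodule of `V = ℚ ⊗ M` of vectors pairing integrally with a sublattice
`N ⊆ M`. -/
noncomputable def integralPairing (B : M →ₗ[ℤ] M →ₗ[ℤ] ℤ) (N : Submodule ℤ M) :
    Submodule ℤ (V M) where
  carrier := {v | ∀ y ∈ N, ∃ n : ℤ, BQ B v (ι y) = (n : ℚ)}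
  zero_mem' := by
    intro y hy
    exact ⟨0, by simp⟩
  add_mem' := by
    intro a b ha hb y hy
    obtain ⟨n, hn⟩ := ha y hy
    obtain ⟨m, hm⟩ := hb y hy
    refine ⟨n + m, ?_⟩
    rw [map_add, LinearMap.add_apply, hn, hm]
    push_cast
    ring
  smul_mem' := by
    intro c v hv y hy
    obtain ⟨n, hn⟩ := hv y hy
    refine ⟨c * n, ?_⟩
    rw [map_zsmul, LinearMap.smul_apply, hn, zsmul_eq_mul]
    push_cast
    ring

/-- The dual lattice `L* = {v ∈ ℚ·L | B(v, L) ⊆ ℤ}` of a nondegenerate sublattice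
`L ⊆ M`, realized inside `V = ℚ ⊗ M`; the discriminant group is `𝓛 = L*/L`. -/
noncomputable def dualLattice (B : M →ₗ[ℤ] M →ₗ[ℤ] ℤ) (L : Submodule ℤ M) :
    Submodule ℤ (V M) :=
  (Submodule.span ℚ (ι '' (L : Set M))).restrictScalars ℤ ⊓ integralPairing B L

/-- The preimage in `L*` of `K^⊥ ⊆ 𝓛 = L*/L`, where `K = L̃/L` is the kernel of the
finite-index extension `L̃ ⊇ L`: it consists of the vectors of `L*` pairing integrally
with the primitive hull `L̃`. -/
noncomputable def kPerpPreimage (B : M →ₗ[ℤ] M →ₗ[ℤ] ℤ) (L : Submodule ℤ M) :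
    Submodule ℤ (V M) :=
  dualLattice B L ⊓ integralPairing B (primHull L)

end Lattices

open Lattices

namespace Lattices

section

variable {M : Type*} [AddCommGroup M]

theorem ι_injective [Module.Free ℤ M] : Function.Injective (ι : M →ₗ[ℤ] V M) :=
  Module.Flat.tensorProduct_mk_injective (R := ℤ) (S := ℚ) M

theorem BQ_ι (B : M →ₗ[ℤ] M →ₗ[ℤ] ℤ) (x y : M) : BQ B (ι x) (ι y) = (B x y : ℚ) := by
  change LinearMap.BilinForm.baseChange ℚ B (1 ⊗ₜ[ℤ] x) (1 ⊗ₜ[ℤ] y) = _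
  simp [LinearMap.BilinForm.baseChange_tmul]

/-- Every vector of the rational span of a sublattice has a nonzero multiple in the
sublattice. -/
theorem exists_smul_eq_ι_of_mem_span {L : Submodule ℤ M} {v : V M}
    (hv : v ∈ Submodule.span ℚ (ι '' (L : Set M))) :
    ∃ n : ℤ, n ≠ 0 ∧ ∃ l ∈ L, n • v = ι l := by
  induction hv using Submodule.span_induction with
  | mem x hx =>
    obtain ⟨l, hl, rfl⟩ := hx
    exact ⟨1, one_ne_zero, l, hl, one_smul _ _⟩
  | zero => exact ⟨1, one_ne_zero, 0, L.zero_mem, by simp⟩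
  | add x y _ _ hx hy =>
    obtain ⟨n, hn, l, hl, hnl⟩ := hx
    obtain ⟨m, hm, k, hk, hmk⟩ := hy
    refine ⟨n * m, mul_ne_zero hn hm, m • l + n • k,
      L.add_mem (L.smul_mem m hl) (L.smul_mem n hk), ?_⟩
    rw [map_add, map_smul, map_smul, ← hnl, ← hmk, smul_add, mul_smul n m y, mul_comm, mul_smul]
  | smul q x _ hx =>
    obtain ⟨n, hn, l, hl, hnl⟩ := hx
    refine ⟨n * q.den, mul_ne_zero hn (by exact_mod_cast q.den_ne_zero), q.num • l,
      L.smul_mem _ hl, ?_⟩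
    rw [map_smul, ← hnl, ← Int.cast_smul_eq_zsmul ℚ, ← Int.cast_smul_eq_zsmul ℚ,
      ← Int.cast_smul_eq_zsmul ℚ, smul_smul, smul_smul]
    congr 1
    push_cast
    rw [mul_assoc, mul_comm (q.den : ℚ), Rat.mul_den_eq_num, mul_comm]

theorem le_primHull (L : Submodule ℤ M) : L ≤ primHull L :=
  fun x hx => ⟨1, one_ne_zero, by simpa using hx⟩

theorem mem_primHull_of_smul_mem {L : Submodule ℤ M} {n : ℤ} {x : M} (hn : n ≠ 0)
    (h : n • x ∈ primHull L) : x ∈ primHull L := by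
  obtain ⟨k, hk, hx⟩ := h
  exact ⟨k * n, mul_ne_zero hk hn, by rwa [mul_smul]⟩

/-- A vector orthogonal to `L` is orthogonal to the primitive hull of `L`. -/
theorem apply_eq_zero_of_mem_perp {B : M →ₗ[ℤ] M →ₗ[ℤ] ℤ} {L : Submodule ℤ M} {p y : M}
    (hp : p ∈ perp B L) (hy : y ∈ primHull L) : B p y = 0 := by
  obtain ⟨k, hk, hky⟩ := hy
  have h : B p (k • y) = 0 := hp _ hky
  rw [map_smul, smul_eq_mul] at h
  exact (mul_eq_zero.1 h).resolve_left hk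

/-- For a nondegenerate sublattice `L`, the sublattice `L ⊕ L^⊥` has finite index in `M`. -/
theorem exists_smul_eq_add_mem_perp [Module.Free ℤ M] [Module.Finite ℤ M]
    (B : M →ₗ[ℤ] M →ₗ[ℤ] ℤ) (L : Submodule ℤ M)
    (hnondeg : ∀ x ∈ L, (∀ y ∈ L, B x y = 0) → x = 0) (m : M) :
    ∃ n : ℤ, n ≠ 0 ∧ ∃ l ∈ L, ∃ p ∈ perp B L, n • m = l + p := by
  let g : M →ₗ[ℤ] (L →ₗ[ℤ] ℤ) := (LinearMap.lcomp ℤ ℤ L.subtype).comp B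
  let f : L →ₗ[ℤ] (L →ₗ[ℤ] ℤ) := g.comp L.subtype
  have hf : Function.Injective f := by
    rw [injective_iff_map_eq_zero]
    intro x hx
    exact Subtype.ext (hnondeg x x.2 fun y hy => LinearMap.congr_fun hx ⟨y, hy⟩)
  have hr : Module.finrank ℤ (LinearMap.range f) = Module.finrank ℤ (L →ₗ[ℤ] ℤ) := by
    rw [LinearMap.finrank_range_of_inj hf, Module.finrank_linearMap_self]
  have hfin := Submodule.finiteQuotientOfFreeOfRankEq _ hr
  have hmem : (Nat.card ((L →ₗ[ℤ] ℤ) ⧸ LinearMap.range f)) • g m ∈ LinearMap.range f := by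
    rw [← Submodule.Quotient.mk_eq_zero, Submodule.Quotient.mk_smul]
    exact card_nsmul_eq_zero'
  obtain ⟨l, hl⟩ := hmem
  refine ⟨Nat.card ((L →ₗ[ℤ] ℤ) ⧸ LinearMap.range f), by exact_mod_cast Nat.card_pos.ne', l, l.2,
    (Nat.card ((L →ₗ[ℤ] ℤ) ⧸ LinearMap.range f) : ℤ) • m - l, ?_, by abel⟩
  intro y hy
  have h := LinearMap.congr_fun hl ⟨y, hy⟩
  simp only [f, g, LinearMap.comp_apply, LinearMap.lcomp_apply, LinearMap.smul_apply,
    Submodule.subtype_apply] at h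
  rw [map_sub, map_smul, LinearMap.sub_apply, LinearMap.smul_apply, h, natCast_zsmul]
  exact sub_self _

/-- The primitive hull is a direct summand. -/
theorem exists_retraction_primHull [Module.Finite ℤ M] (L : Submodule ℤ M) :
    ∃ r : M →ₗ[ℤ] M, (∀ x, r x ∈ primHull L) ∧ ∀ x ∈ primHull L, r x = x := by
  have : Module.IsTorsionFree ℤ (M ⧸ primHull L) := by
    apply Module.IsTorsionFree.of_smul_eq_zero
    intro n x hx
    obtain ⟨x, rfl⟩ := Submodule.Quotient.mk_surjective _ x
    by_cases hn : n = 0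
    · exact Or.inl hn
    · rw [← Submodule.Quotient.mk_smul, Submodule.Quotient.mk_eq_zero] at hx
      exact Or.inr ((Submodule.Quotient.mk_eq_zero _).2 (mem_primHull_of_smul_mem hn hx))
  obtain ⟨s, hs⟩ := LinearMap.exists_rightInverse_of_surjective (primHull L).mkQ
    (Submodule.range_mkQ _)
  refine ⟨LinearMap.id - s.comp (primHull L).mkQ, fun x => ?_, fun x hx => ?_⟩
  · apply (Submodule.Quotient.mk_eq_zero _).1
    rw [← Submodule.mkQ_apply, LinearMap.sub_apply, map_sub, sub_eq_zero]
    exact (LinearMap.congr_fun hs ((primHull L).mkQ x)).symm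
  · have h : (primHull L).mkQ x = 0 := (Submodule.Quotient.mk_eq_zero _).2 hx
    simp only [LinearMap.sub_apply, LinearMap.comp_apply, h, map_zero, sub_zero, LinearMap.id_apply]

/-- In a unimodular lattice, a rational vector pairing integrally with the primitive hull of
`L` pairs with it like some lattice vector. -/
theorem exists_apply_eq_of_mem_integralPairing [Module.Finite ℤ M]
    {B : M →ₗ[ℤ] M →ₗ[ℤ] ℤ} (hB : Function.Surjective fun x : M => B x)
    {L : Submodule ℤ M} {v : V M} (hv : v ∈ integralPairing B (primHull L)) :
    ∃ m : M, ∀ y ∈ primHull L, BQ B v (ι y) = (B m y : ℚ) := by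
  obtain ⟨r, hr, hr'⟩ := exists_retraction_primHull L
  let f : M →ₗ[ℤ] ℚ := ((BQ B v).restrictScalars ℤ).comp (ι.comp r)
  have hcast : Function.Injective (Algebra.linearMap ℤ ℚ) := Int.cast_injective
  have hf : ∀ x, f x ∈ LinearMap.range (Algebra.linearMap ℤ ℚ) := fun x => by
    obtain ⟨n, hn⟩ := hv _ (hr x)
    exact ⟨n, hn.symm⟩
  obtain ⟨m, hm⟩ := hB (LinearMap.codRestrictOfInjective f _ hcast hf)
  refine ⟨m, fun y hy => ?_⟩
  have h := LinearMap.codRestrictOfInjective_comp_apply f _ hcast hf y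
  have hm' : B m = LinearMap.codRestrictOfInjective f _ hcast hf := hm
  rw [← hm'] at h
  simpa [f, hr' y hy] using h.symm

/-- A form-preserving endomorphism of a unimodular lattice whose image has finite index is
bijective. -/
theorem bijective_of_isometry {B : M →ₗ[ℤ] M →ₗ[ℤ] ℤ}
    (hB : Function.Bijective fun x : M => B x) (Φ : M →ₗ[ℤ] M)
    (hΦ : ∀ x y, B (Φ x) (Φ y) = B x y) (hind : ∀ y, ∃ n : ℤ, n ≠ 0 ∧ ∃ x, n • y = Φ x) :
    Function.Bijective Φ := by
  constructor
  · rw [injective_iff_map_eq_zero]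
    intro x hx
    apply hB.1
    ext y
    simp [← hΦ x y, hx]
  · intro y
    obtain ⟨z, hz⟩ := hB.2 ((B y).comp Φ)
    have hz' : B z = (B y).comp Φ := hz
    refine ⟨z, hB.1 ?_⟩
    ext w
    obtain ⟨n, hn, x, hx⟩ := hind w
    apply mul_left_cancel₀ hn
    simp only [← smul_eq_mul, ← map_smul, hx, hΦ, hz', LinearMap.comp_apply]

/-- An isometry of a unimodular lattice that is the identity on `L^⊥` acts as the identity on
`K^⊥/K`. -/
theorem baseChange_sub_mem_map_primHull [Module.Free ℤ M] [Module.Finite ℤ M]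
    {B : M →ₗ[ℤ] M →ₗ[ℤ] ℤ} (hB : Function.Surjective fun x : M => B x)
    {L : Submodule ℤ M} (Φ : M →ₗ[ℤ] M) (hL : ∀ x ∈ L, Φ x ∈ L)
    (hperp : ∀ x ∈ perp B L, Φ x = x) {v : V M} (hv : v ∈ kPerpPreimage B L) :
    Φ.baseChange ℚ v - v ∈ Submodule.map (ι (M := M)) (primHull L) := by
  have hι : ∀ x, Φ.baseChange ℚ (ι x) = ι (Φ x) := fun x => rfl
  obtain ⟨⟨hspan, -⟩, hint⟩ := hv
  obtain ⟨m, hm⟩ := exists_apply_eq_of_mem_integralPairing hB hint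
  obtain ⟨n, hn, l, hl, hnl⟩ := exists_smul_eq_ι_of_mem_span hspan
  have hp : n • m - l ∈ perp B L := by
    intro y hy
    have h1 : (B l y : ℚ) = n * B m y := by
      rw [← hm y (le_primHull L hy), ← BQ_ι, ← hnl, map_zsmul, LinearMap.smul_apply,
        zsmul_eq_mul]
    have h2 : B l y = n * B m y := by exact_mod_cast h1
    simp [h2]
  have hΦ : n • (Φ m - m) = Φ l - l := by
    have h := hperp _ hp
    rw [map_sub, map_smul] at h
    rw [smul_sub, sub_eq_sub_iff_sub_eq_sub, h]
  refine ⟨Φ m - m, mem_primHull_of_smul_mem hn ?_, ?_⟩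
  · rw [hΦ]
    exact le_primHull L (L.sub_mem (hL l hl) hl)
  · have hnQ : (n : ℚ) ≠ 0 := by exact_mod_cast hn
    apply smul_right_injective (V M) hnQ
    change (n : ℚ) • ι (Φ m - m) = (n : ℚ) • (Φ.baseChange ℚ v - v)
    rw [Int.cast_smul_eq_zsmul, Int.cast_smul_eq_zsmul, ← map_smul, hΦ, smul_sub, ← map_zsmul (Φ.baseChange ℚ), hnl, hι, map_sub]

/-- An endomorphism of `ℚ ⊗ M` that fixes `L^⊥` and acts as the identity on `K^⊥/K` preserves
`M`. -/
theorem apply_ι_mem_range [Module.Free ℤ M] [Module.Finite ℤ M]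
    {B : M →ₗ[ℤ] M →ₗ[ℤ] ℤ} {L : Submodule ℤ M}
    (hnondeg : ∀ x ∈ L, (∀ y ∈ L, B x y = 0) → x = 0) (cV : V M →ₗ[ℚ] V M)
    (hperp : ∀ x ∈ perp B L, cV (ι x) = ι x)
    (hK : ∀ v ∈ kPerpPreimage B L, cV v - v ∈ Submodule.map (ι (M := M)) (primHull L)) (m : M) :
    cV (ι m) ∈ LinearMap.range (ι (M := M)) := by
  obtain ⟨n, hn, l, hl, p, hp, hnm⟩ := exists_smul_eq_add_mem_perp B L hnondeg m
  have hnQ : (n : ℚ) ≠ 0 := by exact_mod_cast hn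
  have hpair : ∀ y ∈ primHull L, BQ B ((n : ℚ)⁻¹ • ι l) (ι y) = (B m y : ℚ) := by
    intro y hy
    have h : n * B m y = B l y := by
      have h1 := congrArg (fun x => B x y) hnm
      simpa [apply_eq_zero_of_mem_perp hp hy] using h1
    rw [map_smul, LinearMap.smul_apply, BQ_ι, ← h, smul_eq_mul]
    push_cast
    field_simp
  have hv : (n : ℚ)⁻¹ • ι l ∈ kPerpPreimage B L :=
    ⟨⟨(Submodule.span ℚ (ι '' (L : Set M))).smul_mem _ (Submodule.subset_span ⟨l, hl, rfl⟩),
      fun y hy => ⟨_, hpair y (le_primHull L hy)⟩⟩, fun y hy => ⟨_, hpair y hy⟩⟩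
  have hm : ι m = (n : ℚ)⁻¹ • ι l + (n : ℚ)⁻¹ • ι p := by
    rw [← smul_add, ← map_add, ← hnm, map_smul, ← Int.cast_smul_eq_zsmul ℚ, inv_smul_smul₀ hnQ]
  obtain ⟨k, -, hk⟩ := hK _ hv
  refine ⟨k + m, ?_⟩
  rw [map_add, hk, hm, map_add, map_smul cV _ (ι p), hperp p hp]
  abel

end

end Lattices

/-- Nikulin's extension criterion (Corollary `extension` of the paper).  Let `M` be an
even unimodular lattice, `L ⊆ M` a sublattice on which the form is nondegenerate, `L̃`
the primitive hull of `L` in `M`, `K = L̃/L ⊆ 𝓛 = L*/L` the kernel of the extension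
`L̃ ⊇ L`, and let `c` be an isometry of `L`.  Then `c ⊕ id_{L^⊥}` extends to an isometry
of `M` if and only if the automorphism of `𝓛` induced by `c` maps `K` onto `K` and
induces the identity on `K^⊥/K`.  (The discriminant conditions are expressed via the
unique `ℚ`-linear extension `cV` of `c ⊕ id` to `V = ℚ ⊗ M`: the induced automorphism of
`𝓛` preserves `K` iff `cV` maps `L̃` into `L̃` modulo `L`, and it induces the identity on
`K^⊥/K` iff `cV v − v ∈ L̃ (mod L)` for every `v` in the preimage of `K^⊥`.) -/
theorem nikulin_extension_criterion
    {M : Type*} [AddCommGroup M] [Module.Free ℤ M] [Module.Finite ℤ M]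
    (B : M →ₗ[ℤ] M →ₗ[ℤ] ℤ)
    (hsymm : ∀ x y : M, B x y = B y x)
    (heven : ∀ x : M, Even (B x x))
    (hunimodular : Function.Bijective fun x : M => B x)
    (L : Submodule ℤ M)
    (hnondeg : ∀ x ∈ L, (∀ y ∈ L, B x y = 0) → x = 0)
    (c : ↥L ≃ₗ[ℤ] ↥L)
    (hc : ∀ x y : ↥L, B (c x : M) (c y : M) = B (x : M) (y : M)) :
    (∃ Φ : M ≃ₗ[ℤ] M,
        (∀ x y : M, B (Φ x) (Φ y) = B x y) ∧
        (∀ x : ↥L, Φ (x : M) = (c x : M)) ∧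
        (∀ x ∈ perp B L, Φ x = x)) ↔
    (∃ cV : V M →ₗ[ℚ] V M,
        (∀ x : ↥L, cV (ι (x : M)) = ι ((c x : M))) ∧
        (∀ x ∈ perp B L, cV (ι x) = ι x) ∧
        (∀ x ∈ primHull L, cV (ι x) ∈ Submodule.map (ι (M := M)) (primHull L)) ∧
        (∀ x ∈ primHull L, ∃ y ∈ primHull L, cV (ι y) = ι x) ∧
        (∀ v ∈ kPerpPreimage B L,
          cV v - v ∈ Submodule.map (ι (M := M)) (primHull L))) := by
  constructor
  · rintro ⟨Φ, -, hΦL, hΦperp⟩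
    have hmem : ∀ x ∈ L, Φ x ∈ L := fun x hx => by
      rw [hΦL ⟨x, hx⟩]
      exact (c _).2
    have hsymm_mem : ∀ x ∈ L, Φ.symm x ∈ L := fun x hx => by
      have h := hΦL (c.symm ⟨x, hx⟩)
      rw [LinearEquiv.apply_symm_apply] at h
      rw [← show Φ (c.symm ⟨x, hx⟩) = x from h, LinearEquiv.symm_apply_apply]
      exact (c.symm _).2
    have hι : ∀ x, (Φ : M →ₗ[ℤ] M).baseChange ℚ (ι x) = ι (Φ x) := fun x => rfl
    refine ⟨(Φ : M →ₗ[ℤ] M).baseChange ℚ, fun x => by rw [hι, hΦL],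
      fun x hx => by rw [hι, hΦperp x hx], ?_, ?_,
      fun v hv => baseChange_sub_mem_map_primHull hunimodular.2 _ hmem hΦperp hv⟩
    · rintro x ⟨n, hn, hx⟩
      exact ⟨Φ x, ⟨n, hn, by simpa only [map_smul] using hmem _ hx⟩, rfl⟩
    · rintro x ⟨n, hn, hx⟩
      refine ⟨Φ.symm x, ⟨n, hn, by simpa only [map_smul] using hsymm_mem _ hx⟩, ?_⟩
      rw [hι, LinearEquiv.apply_symm_apply]
  · rintro ⟨cV, hcL, hcperp, -, -, hK⟩
    have hrange := apply_ι_mem_range hnondeg cV hcperp hK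
    let Φ : M →ₗ[ℤ] M := LinearMap.codRestrictOfInjective
      ((cV.restrictScalars ℤ).comp ι) ι ι_injective hrange
    have hΦ : ∀ x, ι (Φ x) = cV (ι x) := LinearMap.codRestrictOfInjective_comp_apply
      ((cV.restrictScalars ℤ).comp ι) ι ι_injective hrange
    have hΦL : ∀ x : L, Φ x = c x := fun x => ι_injective (by rw [hΦ, hcL])
    have hΦperp : ∀ x ∈ perp B L, Φ x = x := fun x hx => ι_injective (by rw [hΦ, hcperp x hx])
    have hdecomp := exists_smul_eq_add_mem_perp B L hnondeg
    have hiso : ∀ x y, B (Φ x) (Φ y) = B x y := by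
      intro x y
      obtain ⟨n, hn, l, hl, p, hp, hx⟩ := hdecomp x
      obtain ⟨n', hn', l', hl', p', hp', hy⟩ := hdecomp y
      have horth : ∀ q ∈ perp B L, ∀ z : L, B z q = 0 := fun q hq z => by
        rw [hsymm]
        exact hq z z.2
      have h : B (Φ (n • x)) (Φ (n' • y)) = B (n • x) (n' • y) := by
        rw [hx, hy, map_add Φ, map_add Φ, hΦperp p hp, hΦperp p' hp', hΦL ⟨l, hl⟩, hΦL ⟨l', hl'⟩]
        simp only [map_add, LinearMap.add_apply, hc, horth p' hp' (c _), hp _ (c _).2, hp _ hl',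
          horth p' hp' ⟨l, hl⟩]
      simp only [map_smul, LinearMap.smul_apply, smul_eq_mul] at h
      exact mul_left_cancel₀ hn (mul_left_cancel₀ hn' h)
    have hbij : Function.Bijective Φ := by
      refine bijective_of_isometry hunimodular Φ hiso fun y => ?_
      obtain ⟨n, hn, l, hl, p, hp, hy⟩ := hdecomp y
      refine ⟨n, hn, c.symm ⟨l, hl⟩ + p, ?_⟩
      rw [hy, map_add, hΦL, hΦperp p hp, LinearEquiv.apply_symm_apply]
    exact ⟨LinearEquiv.ofBijective Φ hbij, hiso, hΦL, hΦperp⟩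
end
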